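/- Let H be a Hopf algebra with the dual Chevalley property, C a simple subcoalgebra with basic multiplicative matrix 𝒞, 𝒳 a non-trivial (𝒞,1)-primitive matrix, and Λ₀ ∈ 1 + Σ_{D∈𝒮∖{k1}} D. Then Λ₀𝒳 ≠ 0 and 𝒳Λ₀ ≠ 0. -/

import Mathlib

open TensorProduct

noncomputable section

variable (k H : Type*) [CommRing k] [Ring H] [Bialgebra k H]

/-- Convolution product `f * g = m ∘ (f ⊗ g) ∘ Δ` on linear endomorphisms. -/
def conv (f g : Module.End k H) : Module.End k H :=
  LinearMap.mul' k H ∘ₗ TensorProduct.map f g ∘ₗ Coalgebra.comul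

/-- The convolution unit `u ∘ ε`. -/
def convOne : Module.End k H := (Algebra.linearMap k H) ∘ₗ Coalgebra.counit

/-- `convSeq F n = m_n ∘ (F 0 ⊗ F 1 ⊗ ⋯ ⊗ F (n-1)) ∘ Δ_n` (as an iterated convolution). -/
def convSeq : (ℕ → Module.End k H) → ℕ → Module.End k H
  | _, 0 => convOne k H
  | F, n + 1 => conv k H (F 0) (convSeq (fun j => F (j + 1)) n)

/-- The `n`-th Sweedler power `[n] = m_n ∘ Δ_n` as a linear endomorphism. -/
def sweedlerPow (n : ℕ) : Module.End k H := convSeq k H (fun _ => LinearMap.id) n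

/-- The twisted Sweedler power `m_n ∘ (id ⊗ T ⊗ T² ⊗ ⋯ ⊗ T^(n-1)) ∘ Δ_n`. -/
def twistPow (T : Module.End k H) (n : ℕ) : Module.End k H :=
  convSeq k H (fun j => T ^ j) n

/-- `exp₀(H)`: the least `n ≥ 1` with `[n] = u ∘ ε`, in `ℕ ∪ {∞}` (`sInf ∅ = ∞`). -/
def exp0 : ℕ∞ :=
  sInf {e : ℕ∞ | ∃ n : ℕ, e = n ∧ 0 < n ∧ sweedlerPow k H n = convOne k H}

/-- The `T`-twisted exponent: least `n ≥ 1` with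
`m_n ∘ (id ⊗ T ⊗ ⋯ ⊗ T^(n-1)) ∘ Δ_n = u ∘ ε`, in `ℕ ∪ {∞}`.  For `T = S⁻²` this is
`exp(H)` and for `T = S^(2i)` this is the twisted exponent `exp_{2i}(H)`. -/
def expAt (T : Module.End k H) : ℕ∞ :=
  sInf {e : ℕ∞ | ∃ n : ℕ, e = n ∧ 0 < n ∧ twistPow k H T n = convOne k H}

/-- `S` is a subcoalgebra: `Δ(S) ⊆ S ⊗ S` (as a subspace of `H ⊗ H`). -/
def IsSubcoalg (S : Submodule k H) : Prop :=
  ∀ s ∈ S, Coalgebra.comul (R := k) s ∈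
    LinearMap.range (TensorProduct.map S.subtype S.subtype)

/-- `S` is a simple subcoalgebra: nonzero, a subcoalgebra, and with no proper nonzero
subcoalgebras. -/
def IsSimpleSubcoalg (S : Submodule k H) : Prop :=
  S ≠ ⊥ ∧ IsSubcoalg k H S ∧ ∀ T ≤ S, IsSubcoalg k H T → T = ⊥ ∨ T = S

/-- The coradical `H₀`: the sum of all simple subcoalgebras. -/
def coradical : Submodule k H := sSup {S : Submodule k H | IsSimpleSubcoalg k H S}

/-- The image of `S ⊗ T` in `H ⊗ H`. -/
def tsub (S T : Submodule k H) : Submodule k (H ⊗[k] H) :=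
  LinearMap.range (TensorProduct.map S.subtype T.subtype)

/-- The coradical filtration, `H_0 = H₀` and `H_n = Δ⁻¹(H ⊗ H_{n-1} + H₀ ⊗ H)`. -/
def coradFilt : ℕ → Submodule k H
  | 0 => coradical k H
  | n + 1 => Submodule.comap (Coalgebra.comul (R := k))
      (tsub k H ⊤ (coradFilt n) ⊔ tsub k H (coradical k H) ⊤)

/-- The Loewy length: the least `l ≥ 1` with `H_{l-1} = H`. -/
def loewyLength : ℕ := sInf {l : ℕ | 0 < l ∧ coradFilt k H (l - 1) = ⊤}

/-- The dual Chevalley property: the coradical is a Hopf subalgebra, i.e. it contains `1`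
and is closed under multiplication and the antipode. -/
def DualChevalley [HopfAlgebra k H] : Prop :=
  (1 : H) ∈ coradical k H ∧
  (∀ a ∈ coradical k H, ∀ b ∈ coradical k H, a * b ∈ coradical k H) ∧
  (∀ a ∈ coradical k H, HopfAlgebra.antipode (R := k) a ∈ coradical k H)

theorem aux_functional {k V : Type*} [Field k] [AddCommGroup V] [Module k V]
    (M : Submodule k V) (v : V) (hv : v ∉ M) :
    ∃ f : V →ₗ[k] k, f v = 1 ∧ ∀ m ∈ M, f m = 0 := by
  obtain ⟨f, hf, hM⟩ := M.exists_le_ker_of_notMem hv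
  refine ⟨(f v)⁻¹ • f, by simp [hf], fun m hm => ?_⟩
  have : f m = 0 := hM hm
  simp [this]

theorem aux_span {k H : Type*} [Field k] [Ring H] [Bialgebra k H]
    (A : Submodule k H) (hA : IsSubcoalg k H A) (N : Submodule k (H ⊗[k] H))
    (h : ∀ a ∈ A, ∀ b ∈ A, a ⊗ₜ[k] b ∈ N) (a : H) (ha : a ∈ A) :
    Coalgebra.comul (R := k) a ∈ N := by
  obtain ⟨t, ht⟩ := hA a ha
  rw [← ht]
  clear ht
  induction t with
  | zero => simp
  | tmul u v => exact h u u.2 v v.2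
  | add u v hu hv => rw [map_add]; exact N.add_mem hu hv

/-- The functional `p ⊗ f`. -/
def auxPhi {k H : Type*} [Field k] [Ring H] [Bialgebra k H] (p f : H →ₗ[k] k) :
    H ⊗[k] H →ₗ[k] k := LinearMap.mul' k k ∘ₗ TensorProduct.map p f

theorem auxPhi_tmul {k H : Type*} [Field k] [Ring H] [Bialgebra k H] (p f : H →ₗ[k] k)
    (a b : H) : auxPhi p f (a ⊗ₜ[k] b) = p a * f b := by
  simp [auxPhi]

theorem aux_sup_subcoalg {k H : Type*} [Field k] [Ring H] [Bialgebra k H]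
    (A B : Submodule k H) (h1 : (1 : H) ∈ A ⊔ B) (hA : IsSubcoalg k H A)
    (hB : IsSubcoalg k H B) : (1 : H) ∈ A ∨ (1 : H) ∈ B := by
  by_contra hcon
  push Not at hcon
  obtain ⟨f, hf1, hfA⟩ := aux_functional A 1 hcon.1
  obtain ⟨g, hg1, hgB⟩ := aux_functional B 1 hcon.2
  have hle : A ⊔ B ≤ LinearMap.ker (auxPhi f g ∘ₗ Coalgebra.comul (R := k)) := by
    refine sup_le ?_ ?_
    · intro a ha
      exact aux_span A hA (LinearMap.ker (auxPhi f g))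
        (fun a ha b hb => by simp [auxPhi_tmul, hfA a ha]) a ha
    · intro a ha
      exact aux_span B hB (LinearMap.ker (auxPhi f g))
        (fun a ha b hb => by simp [auxPhi_tmul, hgB b hb]) a ha
  have := hle h1
  rw [LinearMap.mem_ker, LinearMap.comp_apply, Bialgebra.comul_one,
    Algebra.TensorProduct.one_def, auxPhi_tmul, hf1, hg1] at this
  simp at this

theorem aux_subcoalg_sup {k H : Type*} [Field k] [Ring H] [Bialgebra k H]
    (A B : Submodule k H) (hA : IsSubcoalg k H A)
    (hB : IsSubcoalg k H B) : IsSubcoalg k H (A ⊔ B) := by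
  have hle : A ⊔ B ≤ (LinearMap.range (TensorProduct.map (A ⊔ B).subtype (A ⊔ B).subtype)).comap
      (Coalgebra.comul (R := k)) := by
    refine sup_le ?_ ?_
    · intro a ha
      exact aux_span A hA (LinearMap.range (TensorProduct.map (A ⊔ B).subtype (A ⊔ B).subtype)) (fun a ha b hb =>
        ⟨(⟨a, le_sup_left (b := B) ha⟩ : ↥(A ⊔ B)) ⊗ₜ
          (⟨b, le_sup_left (b := B) hb⟩ : ↥(A ⊔ B)), by simp⟩) a ha
    · intro a ha
      exact aux_span B hB (LinearMap.range (TensorProduct.map (A ⊔ B).subtype (A ⊔ B).subtype)) (fun a ha b hb =>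
        ⟨(⟨a, le_sup_right (a := A) ha⟩ : ↥(A ⊔ B)) ⊗ₜ
          (⟨b, le_sup_right (a := A) hb⟩ : ↥(A ⊔ B)), by simp⟩) a ha
  exact fun s hs => hle hs

theorem aux_finset {k H : Type*} [Field k] [Ring H] [Bialgebra k H]
    (s : Finset (Submodule k H)) (hs : ∀ A ∈ s, IsSubcoalg k H A) :
    IsSubcoalg k H (s.sup id) ∧ ((1 : H) ∈ s.sup id → (1 : H) = 0 ∨ ∃ A ∈ s, (1 : H) ∈ A) := by
  classical
  induction s using Finset.induction_on with
  | empty =>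
    refine ⟨fun s hs => ?_, fun h => Or.inl (by simpa using h)⟩
    have : s = 0 := by simpa using hs
    subst this
    simp
  | insert A s hAs ih =>
    obtain ⟨ih1, ih2⟩ := ih (fun B hB => hs B (Finset.mem_insert_of_mem hB))
    have hA := hs A (Finset.mem_insert_self _ _)
    rw [Finset.sup_insert]
    refine ⟨aux_subcoalg_sup _ _ hA ih1, fun h => ?_⟩
    rcases aux_sup_subcoalg _ _ h hA ih1 with h | h
    · exact Or.inr ⟨A, Finset.mem_insert_self _ _, h⟩
    · rcases ih2 h with h | ⟨B, hB, h⟩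
      · exact Or.inl h
      · exact Or.inr ⟨B, Finset.mem_insert_of_mem hB, h⟩

theorem aux_one_notMem {k H : Type*} [Field k] [Ring H] [Bialgebra k H] :
    (1 : H) ∉ sSup {S : Submodule k H | IsSimpleSubcoalg k H S ∧
      S ≠ Submodule.span k {(1 : H)}} := by
  intro h
  have h10 : (1 : H) ≠ 0 := by
    intro h
    have := congrArg (Coalgebra.counit (R := k)) h
    simp at this
  have hfin : ∃ s : Finset (Submodule k H), (∀ A ∈ s, A ∈ {S : Submodule k H |
      IsSimpleSubcoalg k H S ∧ S ≠ Submodule.span k {(1 : H)}}) ∧ (1 : H) ∈ s.sup id := by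
    obtain ⟨t, ht, h2⟩ := Submodule.mem_sSup_iff_exists_finset.1 h
    exact ⟨t, fun A hA => ht hA, by simpa [Finset.sup_eq_iSup] using h2⟩
  obtain ⟨s, hs, h1⟩ := hfin
  rcases (aux_finset s (fun A hA => (hs A hA).1.2.1)).2 h1 with h | ⟨A, hA, h1A⟩
  · exact h10 h
  · have hle : Submodule.span k {(1 : H)} ≤ A := (Submodule.span_singleton_le_iff_mem _ _).2 h1A
    have hsub : IsSubcoalg k H (Submodule.span k {(1 : H)}) := by
      intro t ht
      obtain ⟨a, rfl⟩ := Submodule.mem_span_singleton.1 ht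
      refine ⟨a • ((⟨1, Submodule.mem_span_singleton_self _⟩ : Submodule.span k {(1 : H)}) ⊗ₜ
        (⟨1, Submodule.mem_span_singleton_self _⟩ : Submodule.span k {(1 : H)})), ?_⟩
      simp [Algebra.TensorProduct.one_def]
    rcases (hs A hA).1.2.2 _ hle hsub with h | h
    · exact h10 (by simpa using h)
    · exact (hs A hA).2 h.symm

/-- let `H` be a Hopf algebra with the dual Chevalley property,
`𝒞 = (c i j)` a basic multiplicative matrix spanning a simple subcoalgebra `C`,
`x = (x i)` a non-trivial `(𝒞,1)`-primitive matrix, and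
`Λ₀ ∈ 1 + Σ_{D ∈ 𝒮∖{k1}} D`.  Then `Λ₀ 𝒳 ≠ 0` and `𝒳 Λ₀ ≠ 0`. -/
theorem stmt18 (k H : Type*) [Field k] [Ring H] [HopfAlgebra k H]
    (hchev : DualChevalley k H)
    (r : ℕ) (c : Matrix (Fin r) (Fin r) H)
    -- `𝒞` is multiplicative ...
    (hmulM : ∀ i j, Coalgebra.comul (R := k) (c i j) = ∑ l, c i l ⊗ₜ[k] c l j)
    (hcouM : ∀ i j, Coalgebra.counit (R := k) (c i j) = if i = j then (1 : k) else 0)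
    -- ... basic ...
    (hbasic : LinearIndependent k (fun q : Fin r × Fin r => c q.1 q.2))
    -- ... and spans a simple subcoalgebra `C`:
    (hsimple : IsSimpleSubcoalg k H
      (Submodule.span k (Set.range (fun q : Fin r × Fin r => c q.1 q.2))))
    -- `x` is a `(𝒞,1)`-primitive matrix ...
    (x : Fin r → H)
    (hprim : ∀ i, Coalgebra.comul (R := k) (x i) =
      (∑ l, c i l ⊗ₜ[k] x l) + x i ⊗ₜ[k] (1 : H))
    -- ... which is non-trivial:
    (hnontriv : ∃ i, x i ∉ coradical k H)
    -- `Λ₀ ∈ 1 + Σ_{D ∈ 𝒮∖{k1}} D`: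
    (Λ₀ : H)
    (hΛ : Λ₀ - 1 ∈
      sSup {S : Submodule k H | IsSimpleSubcoalg k H S ∧ S ≠ Submodule.span k {(1 : H)}}) :
    (∃ i, Λ₀ * x i ≠ 0) ∧ (∃ i, x i * Λ₀ ≠ 0) := by
  set M := sSup {S : Submodule k H | IsSimpleSubcoalg k H S ∧
    S ≠ Submodule.span k {(1 : H)}} with hM
  obtain ⟨i, hi⟩ := hnontriv
  obtain ⟨f, hf1, hfM⟩ := aux_functional M 1 aux_one_notMem
  obtain ⟨p, hp1, hp0⟩ := aux_functional (coradical k H) (x i) hi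
  have hc : ∀ i j, c i j ∈ coradical k H := fun i j =>
    le_sSup (a := Submodule.span k (Set.range (fun q : Fin r × Fin r => c q.1 q.2))) hsimple
      (Submodule.subset_span ⟨(i, j), rfl⟩)
  have hΛe : Λ₀ = 1 + (Λ₀ - 1) := by abel
  -- common vanishing principle
  have key : ∀ T : H ⊗[k] H →ₗ[k] H ⊗[k] H,
      (∀ D : Submodule k H, IsSimpleSubcoalg k H D → D ≤ M → ∀ a ∈ D, ∀ b ∈ D,
        auxPhi p f (T (a ⊗ₜ[k] b)) = 0) →
      auxPhi p f (T (Coalgebra.comul (R := k) (Λ₀ - 1))) = 0 := by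
    intro T hT
    have hle : M ≤ LinearMap.ker ((auxPhi p f ∘ₗ T) ∘ₗ Coalgebra.comul (R := k)) := by
      refine sSup_le fun D hD a ha => ?_
      exact aux_span D hD.1.2.1 (LinearMap.ker (auxPhi p f ∘ₗ T))
        (fun a ha b hb => hT D hD.1 (le_sSup hD) a ha b hb) a ha
    exact hle hΛ
  have hx : auxPhi p f (Coalgebra.comul (R := k) (x i)) = 1 := by
    rw [hprim, map_add, map_sum, auxPhi_tmul, hp1, hf1]
    simp [auxPhi_tmul, hp0 _ (hc _ _)]
  refine ⟨⟨i, fun h0 => ?_⟩, ⟨i, fun h0 => ?_⟩⟩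
  · have h1 := key (LinearMap.mulRight k (Coalgebra.comul (R := k) (x i)))
      (fun D hD hDM a ha b hb => by
        have ha' : a ∈ coradical k H := le_sSup (a := D) hD ha
        simp [hprim, mul_add, Finset.mul_sum, auxPhi_tmul,
          hp0 _ (hchev.2.1 a ha' _ (hc _ _)), hfM b (hDM hb)])
    have h2 := congrArg (fun y => auxPhi p f (Coalgebra.comul (R := k) y)) h0
    rw [hΛe, add_mul, one_mul] at h2
    simp only [map_add, Bialgebra.comul_mul, hx, map_zero] at h2
    rw [LinearMap.mulRight_apply] at h1
    rw [h1] at h2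
    simp at h2
  · have h1 := key (LinearMap.mulLeft k (Coalgebra.comul (R := k) (x i)))
      (fun D hD hDM a ha b hb => by
        have ha' : a ∈ coradical k H := le_sSup (a := D) hD ha
        simp [hprim, add_mul, Finset.sum_mul, auxPhi_tmul,
          hp0 _ (hchev.2.1 _ (hc _ _) a ha'), hfM b (hDM hb)])
    have h2 := congrArg (fun y => auxPhi p f (Coalgebra.comul (R := k) y)) h0
    rw [hΛe, mul_add, mul_one] at h2
    simp only [map_add, Bialgebra.comul_mul, hx, map_zero] at h2
    rw [LinearMap.mulLeft_apply] at h1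
    rw [h1] at h2
    simp at h2
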